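/- For every integer r and all p_0 < 1, ε > 0, and K, there exist a positive λ and a constant C such that the following holds. Let V be a finite set and let f be an r-homogeneous multilinear polynomial in the variables (y_v)_{v∈V} with nonnegative coefficients. Let p ∈ (0, p_0] and let Y = (Y_v)_{v∈V} be i.i.d. Bernoulli(p) random variables. Suppose that for every nonempty B ⊆ V with |B| ≤ r, the partial derivative satisfies ∂_B f(1) ≤ K·(λp)^{|B|−1}·f(1)/|V|, where 1 is the all-ones vector. Then, setting X := f(Y), for every nonnegative real η, −log Pr(X ≤ η·E[X]) ≥ (1−ε)·Φ_p^f(η+ε) − C. -/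

import Mathlib

open Classical

noncomputable section

/-- The probability of the configuration `ω ⊆ V` under the product measure in which
each vertex `v` is retained independently with probability `q v`. -/
def pw {V : Type*} [Fintype V] [DecidableEq V] (q : V → ℝ) (ω : Finset V) : ℝ :=
  (∏ v ∈ ω, q v) * ∏ v ∈ ωᶜ, (1 - q v)

/-- The relative entropy `i_p(q) = D_KL(Ber(q) ‖ Ber(p))`.  (In Lean `Real.log 0 = 0`,
which implements the convention `0 · log 0 = 0`.) -/
def ip (p q : ℝ) : ℝ :=
  q * Real.log (q / p) + (1 - q) * Real.log ((1 - q) / (1 - p))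

/-- `f` evaluated at the Boolean vector `𝟙_ω ∈ {0,1}^V`. -/
def evalInd {V : Type*} [Fintype V] [DecidableEq V] (f : MvPolynomial V ℝ)
    (ω : Finset V) : ℝ :=
  MvPolynomial.eval (fun v => if v ∈ ω then (1 : ℝ) else 0) f

/-- `E[f(Y^{(q)})]`: the expectation of `f` over a vector of independent Bernoulli
variables with success probabilities `q`. -/
def expPoly {V : Type*} [Fintype V] [DecidableEq V] (f : MvPolynomial V ℝ)
    (q : V → ℝ) : ℝ :=
  ∑ ω : Finset V, pw q ω * evalInd f ω

/-- `Φ_p^f(η) = min { ∑_v i_p(q_v) : q ∈ [0,1]^V, E[f(Y^{(q)})] ≤ η E[f(Y)] }`. -/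
def PhiPoly {V : Type*} [Fintype V] [DecidableEq V] (f : MvPolynomial V ℝ)
    (p η : ℝ) : ℝ :=
  sInf {x | ∃ q : V → ℝ, (∀ v, q v ∈ Set.Icc (0 : ℝ) 1) ∧
    expPoly f q ≤ η * expPoly f (fun _ => p) ∧ x = ∑ v, ip p (q v)}

/-- `Pr(f(Y) ≤ η E[f(Y)])` where `Y` is a vector of i.i.d. `Ber(p)` variables. -/
def PrPoly {V : Type*} [Fintype V] [DecidableEq V] (f : MvPolynomial V ℝ)
    (p η : ℝ) : ℝ :=
  ∑ ω : Finset V,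
    if evalInd f ω ≤ η * expPoly f (fun _ => p) then pw (fun _ => p) ω else 0

/-- The iterated partial derivative `∂_B f` with respect to the variables in `B`. -/
def pderivB {V : Type*} [Fintype V] [DecidableEq V] (B : Finset V)
    (f : MvPolynomial V ℝ) : MvPolynomial V ℝ :=
  B.toList.foldr (fun v g => MvPolynomial.pderiv v g) f

section LowerTail

variable {V : Type*} [DecidableEq V]

/-- The indicator of the event that all elements of `S` are present. -/
def ind (S ω : Finset V) : ℝ := if S ⊆ ω then 1 else 0

/-- The function `H` of a configuration depends only on its restriction to `U`. -/
def DependsOnlyOn (U : Finset V) (H : Finset V → ℝ) : Prop :=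
  ∀ ω ω', ω ∩ U = ω' ∩ U → H ω = H ω'

lemma ind_nonneg (S ω : Finset V) : 0 ≤ ind S ω := by
  unfold ind; split_ifs <;> norm_num

lemma ind_mul_ind (S T ω : Finset V) : ind S ω * ind T ω = ind (S ∪ T) ω := by
  unfold ind
  by_cases h1 : S ⊆ ω <;> by_cases h2 : T ⊆ ω <;> simp [h1, h2, Finset.union_subset_iff]

lemma ind_mul_ind_singleton (S : Finset V) (v : V) (ω : Finset V) :
    ind S ω * ind {v} ω = ind (insert v S) ω := by
  rw [ind_mul_ind, Finset.union_comm]; rfl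

lemma ind_empty (ω : Finset V) : ind ∅ ω = 1 := by simp [ind]

lemma DependsOnlyOn.mono {U U' : Finset V} {H : Finset V → ℝ} (h : DependsOnlyOn U H)
    (hU : U ⊆ U') : DependsOnlyOn U' H := fun ω ω' hω => h ω ω' (by
  rw [← Finset.inter_eq_right.2 hU, ← Finset.inter_assoc, ← Finset.inter_assoc, hω])

lemma DependsOnlyOn.mul {U : Finset V} {H H' : Finset V → ℝ} (h : DependsOnlyOn U H)
    (h' : DependsOnlyOn U H') : DependsOnlyOn U (fun ω => H ω * H' ω) := fun ω ω' hω => by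
  simp only [h ω ω' hω, h' ω ω' hω]

lemma dependsOnlyOn_ind {S U : Finset V} (h : S ⊆ U) : DependsOnlyOn U (ind S) :=
  fun ω ω' hω => by
    have key : ∀ ω : Finset V, S ⊆ ω ↔ S ⊆ ω ∩ U := fun ω => by
      rw [Finset.subset_inter_iff]; tauto
    unfold ind
    simp only [key ω, key ω', hω]

lemma inv_pow_card_mul_le {θ : ℝ} (hθ : 0 < θ) (S S' : Finset V) :
    (θ ^ S.card)⁻¹ * (θ ^ S'.card)⁻¹ * θ ^ (S ∪ S').card ≤
      ∑ B ∈ S.powerset with B ⊆ S', (θ ^ B.card)⁻¹ := by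
  have h1 : (θ ^ S.card)⁻¹ * (θ ^ S'.card)⁻¹ * θ ^ (S ∪ S').card = (θ ^ (S ∩ S').card)⁻¹ := by
    have := Finset.card_union_add_card_inter S S'
    have h2 : θ ^ (S ∪ S').card * θ ^ (S ∩ S').card = θ ^ S.card * θ ^ S'.card := by
      rw [← pow_add, ← pow_add, this]
    field_simp
    linarith
  rw [h1]
  refine Finset.single_le_sum (f := fun B : Finset V => (θ ^ B.card)⁻¹)
    (fun B _ => by positivity) ?_
  simp [Finset.inter_subset_left, Finset.inter_subset_right]

variable [Fintype V]

/-- Conditional expectation of `F` given the restriction to `U`, for the weights `μ`. -/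
def cexp (μ : Finset V → ℝ) (U : Finset V) (F : Finset V → ℝ) (ω : Finset V) : ℝ :=
  (∑ ω' with ω' ∩ U = ω ∩ U, μ ω' * F ω') / ∑ ω' with ω' ∩ U = ω ∩ U, μ ω'

/-- Under `μ`, every vertex is present with probability at most `p`, even after reweighting by
a function that decreases when this vertex is added. -/
def NegativelyBiased (μ : Finset V → ℝ) (p : ℝ) : Prop :=
  ∀ (v : V) (h : Finset V → ℝ), (∀ ω, 0 ≤ h ω) → (∀ ω, v ∉ ω → h (insert v ω) ≤ h ω) →
    ∑ ω, μ ω * h ω * ind {v} ω ≤ p * ∑ ω, μ ω * h ω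

lemma sum_prod_mul_prod_compl (f g : V → ℝ) :
    ∑ ω : Finset V, (∏ v ∈ ω, f v) * ∏ v ∈ ωᶜ, g v = ∏ v, (f v + g v) := by
  rw [Finset.prod_add, Finset.powerset_univ]
  simp [Finset.compl_eq_univ_sdiff]

lemma pw_nonneg {q : V → ℝ} (hq : ∀ v, q v ∈ Set.Icc (0 : ℝ) 1) (ω : Finset V) :
    0 ≤ pw q ω :=
  mul_nonneg (Finset.prod_nonneg fun v _ => (hq v).1)
    (Finset.prod_nonneg fun v _ => sub_nonneg.2 (hq v).2)

lemma pw_pos {q : V → ℝ} {ω : Finset V} (h1 : ∀ v ∈ ω, 0 < q v) (h2 : ∀ v ∉ ω, q v < 1) :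
    0 < pw q ω :=
  mul_pos (Finset.prod_pos h1)
    (Finset.prod_pos fun v hv => sub_pos.2 (h2 v (by simpa using hv)))

lemma pw_eq_prod (q : V → ℝ) (ω : Finset V) :
    pw q ω = ∏ v, if v ∈ ω then q v else 1 - q v := by
  unfold pw
  rw [← Finset.prod_mul_prod_compl ω]
  congr 1
  · exact Finset.prod_congr rfl fun v hv => by simp [hv]
  · exact Finset.prod_congr rfl fun v hv => by simp [Finset.mem_compl.1 hv]

lemma sum_pw_mul_ind (q : V → ℝ) (S : Finset V) :
    ∑ ω, pw q ω * ind S ω = ∏ v ∈ S, q v := by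
  have h := sum_prod_mul_prod_compl q (fun v => if v ∈ S then 0 else 1 - q v)
  have h2 : ∏ v, (q v + if v ∈ S then 0 else 1 - q v) = ∏ v ∈ S, q v := by
    rw [← Finset.prod_mul_prod_compl S]
    have h3 : ∏ v ∈ Sᶜ, (q v + if v ∈ S then 0 else 1 - q v) = 1 :=
      Finset.prod_eq_one fun v hv => by simp [Finset.mem_compl.1 hv]
    rw [h3, mul_one]
    exact Finset.prod_congr rfl fun v hv => by simp [hv]
  rw [← h2, ← h]
  refine Finset.sum_congr rfl fun ω _ => ?_
  unfold pw ind
  split_ifs with hS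
  · rw [mul_one]
    congr 1
    refine Finset.prod_congr rfl fun v hv => ?_
    rw [if_neg fun h => Finset.mem_compl.1 hv (hS h)]
  · obtain ⟨v, hv, hv'⟩ := Finset.not_subset.1 hS
    rw [mul_zero, Finset.prod_eq_zero (Finset.mem_compl.2 hv') (by simp [hv]), mul_zero]

lemma sum_pw (q : V → ℝ) : ∑ ω, pw q ω = 1 := by
  simpa [ind_empty] using sum_pw_mul_ind q ∅

lemma sum_pw_mul_card (t : ℝ) :
    ∑ W : Finset V, pw (fun _ => t) W * (W.card : ℝ) = t * Fintype.card V := by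
  have h : ∀ W : Finset V, (W.card : ℝ) = ∑ v, ind {v} W := fun W => by
    simp [ind]
  simp_rw [h, Finset.mul_sum]
  rw [Finset.sum_comm]
  simp [sum_pw_mul_ind, mul_comm t]

lemma sum_pw_fiber_congr {q q' : V → ℝ} {U : Finset V} (h : ∀ v ∈ U, q v = q' v)
    (τ : Finset V) :
    ∑ ω with ω ∩ U = τ, pw q ω = ∑ ω with ω ∩ U = τ, pw q' ω := by
  by_cases hτ : τ ⊆ U
  swap
  · rw [Finset.filter_false_of_mem]
    · simp
    · rintro ω - rfl
      exact hτ Finset.inter_subset_right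
  have key : ∀ q : V → ℝ, ∑ ω with ω ∩ U = τ, pw q ω =
      ∏ v, if v ∈ U then (if v ∈ τ then q v else 1 - q v) else 1 := by
    intro q
    have h := sum_prod_mul_prod_compl
      (fun v => if v ∈ U ∧ v ∉ τ then 0 else q v) (fun v => if v ∈ τ then 0 else 1 - q v)
    have h2 : ∀ v, ((if v ∈ U ∧ v ∉ τ then 0 else q v) + if v ∈ τ then 0 else 1 - q v) =
        if v ∈ U then (if v ∈ τ then q v else 1 - q v) else 1 := by
      intro v
      by_cases h1 : v ∈ U <;> by_cases h2 : v ∈ τ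
      · simp [h1, h2]
      · simp [h1, h2]
      · exact absurd (hτ h2) h1
      · simp [h1, h2]
    simp_rw [h2] at h
    rw [← h, Finset.sum_filter]
    refine Finset.sum_congr rfl fun ω _ => ?_
    split_ifs with hω
    · unfold pw
      congr 1
      · refine Finset.prod_congr rfl fun v hv => ?_
        rw [if_neg]
        rintro ⟨h1, h2⟩
        exact h2 (hω ▸ Finset.mem_inter.2 ⟨hv, h1⟩)
      · refine Finset.prod_congr rfl fun v hv => ?_
        rw [if_neg]
        intro h1
        rw [← hω] at h1
        exact Finset.mem_compl.1 hv (Finset.mem_inter.1 h1).1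
    · symm
      by_contra hne
      obtain ⟨h3, h4⟩ := mul_ne_zero_iff.1 hne
      rw [Finset.prod_ne_zero_iff] at h3 h4
      apply hω
      ext v
      rw [Finset.mem_inter]
      constructor
      · rintro ⟨h5, h6⟩
        by_contra h7
        exact h3 v h5 (by simp [h6, h7])
      · intro h5
        refine ⟨?_, hτ h5⟩
        by_contra h7
        exact h4 v (Finset.mem_compl.2 h7) (by simp [h5])
  rw [key, key]
  refine Finset.prod_congr rfl fun v _ => ?_
  split_ifs with h1 h2
  · exact h v h1
  · rw [h v h1]
  · rfl

lemma sum_pw_of_dependsOnlyOn {p : V → ℝ} {U : Finset V} {Q : Finset V → V → ℝ}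
    (hQ : ∀ v, DependsOnlyOn U (fun ω => Q ω v)) (hp : ∀ ω, ∀ v ∈ U, Q ω v = p v) :
    ∑ ω, pw (Q ω) ω = 1 := by
  rw [← sum_pw p, ← Finset.sum_fiberwise Finset.univ (fun ω => ω ∩ U) fun ω => pw (Q ω) ω,
    ← Finset.sum_fiberwise Finset.univ (fun ω => ω ∩ U) (pw p)]
  refine Finset.sum_congr rfl fun τ _ => ?_
  by_cases hτ : τ ⊆ U
  · rw [← sum_pw_fiber_congr (hp τ) τ]
    refine Finset.sum_congr rfl fun ω hω => ?_
    have : Q ω = Q τ := funext fun v => hQ v ω τ (by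
      rw [(Finset.mem_filter.1 hω).2, Finset.inter_eq_left.2 hτ])
    rw [this]
  · rw [Finset.filter_false_of_mem]
    · simp
    · rintro ω - rfl
      exact hτ Finset.inter_subset_right

lemma dependsOnlyOn_cexp (μ : Finset V → ℝ) (U : Finset V) (F : Finset V → ℝ) :
    DependsOnlyOn U (cexp μ U F) := fun ω ω' hω => by
  unfold cexp; rw [hω]

lemma fiber_pos {μ : Finset V → ℝ} (hμ : ∀ ω, 0 ≤ μ ω) {ω : Finset V} (U : Finset V)
    (h : 0 < μ ω) : 0 < ∑ ω' with ω' ∩ U = ω ∩ U, μ ω' :=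
  h.trans_le (Finset.single_le_sum (f := μ) (fun ω _ => hμ ω) (by simp))

lemma sum_mul_cexp {μ : Finset V → ℝ} (hμ : ∀ ω, 0 ≤ μ ω) {U : Finset V} {H : Finset V → ℝ}
    (hH : DependsOnlyOn U H) (F : Finset V → ℝ) :
    ∑ ω, μ ω * (H ω * cexp μ U F ω) = ∑ ω, μ ω * (H ω * F ω) := by
  have h1 : ∀ ω, μ ω * (H ω * cexp μ U F ω) =
      ∑ ω', if ω' ∩ U = ω ∩ U then
        μ ω' * (H ω' * F ω') * (μ ω / ∑ ω'' with ω'' ∩ U = ω' ∩ U, μ ω'') else 0 := by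
    intro ω
    unfold cexp
    rw [← Finset.sum_filter, Finset.sum_div, Finset.mul_sum, Finset.mul_sum]
    refine Finset.sum_congr rfl fun ω' hω' => ?_
    rw [(Finset.mem_filter.1 hω').2, hH ω' ω (Finset.mem_filter.1 hω').2]
    ring
  simp_rw [h1]
  rw [Finset.sum_comm]
  refine Finset.sum_congr rfl fun ω' _ => ?_
  rw [← Finset.sum_filter, ← Finset.mul_sum, ← Finset.sum_div]
  rcases (hμ ω').eq_or_lt with h0 | h0
  · simp [← h0]
  · simp_rw [eq_comm (a := ω' ∩ U)]
    rw [div_self (fiber_pos hμ U h0).ne', mul_one]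

lemma cexp_nonneg {μ : Finset V → ℝ} (hμ : ∀ ω, 0 ≤ μ ω) (U : Finset V) {F : Finset V → ℝ}
    (hF : ∀ ω, 0 ≤ F ω) (ω : Finset V) : 0 ≤ cexp μ U F ω :=
  div_nonneg (Finset.sum_nonneg fun ω _ => mul_nonneg (hμ ω) (hF ω))
    (Finset.sum_nonneg fun ω _ => hμ ω)

lemma cexp_le_const {μ : Finset V → ℝ} (hμ : ∀ ω, 0 ≤ μ ω) (U : Finset V) {F : Finset V → ℝ}
    {c : ℝ} (hc : 0 ≤ c) (hF : ∀ ω, 0 < μ ω → F ω ≤ c) (ω : Finset V) : cexp μ U F ω ≤ c := by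
  refine div_le_of_le_mul₀ (Finset.sum_nonneg fun ω _ => hμ ω) hc ?_
  rw [Finset.mul_sum]
  refine Finset.sum_le_sum fun ω' _ => ?_
  rcases (hμ ω').eq_or_lt with h0 | h0
  · simp [← h0]
  · rw [mul_comm c]
    exact mul_le_mul_of_nonneg_left (hF ω' h0) h0.le

lemma cexp_sum_mul {ι : Type*} (μ : Finset V → ℝ) (U : Finset V) (s : Finset ι) (a : ι → ℝ)
    (F : ι → Finset V → ℝ) (ω : Finset V) :
    cexp μ U (fun ω => ∑ i ∈ s, a i * F i ω) ω = ∑ i ∈ s, a i * cexp μ U (F i) ω := by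
  unfold cexp
  simp_rw [Finset.mul_sum, mul_div_assoc']
  rw [← Finset.sum_div, Finset.sum_comm]
  simp_rw [Finset.mul_sum]
  congr 1
  refine Finset.sum_congr rfl fun i _ => Finset.sum_congr rfl fun ω _ => by ring

lemma cexp_one {μ : Finset V → ℝ} (hμ : ∀ ω, 0 ≤ μ ω) (U : Finset V) {ω : Finset V}
    (h : 0 < μ ω) : cexp μ U (ind ∅) ω = 1 := by
  unfold cexp
  simp_rw [ind_empty, mul_one]
  exact div_self (fiber_pos hμ U h).ne'

lemma cexp_pos {μ : Finset V → ℝ} (hμ : ∀ ω, 0 ≤ μ ω) (U : Finset V) {F : Finset V → ℝ}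
    (hF : ∀ ω, 0 ≤ F ω) {ω : Finset V} (h : 0 < μ ω) (hω : 0 < F ω) : 0 < cexp μ U F ω := by
  refine div_pos ((mul_pos h hω).trans_le ?_) (fiber_pos hμ U h)
  exact Finset.single_le_sum (f := fun ω => μ ω * F ω)
    (fun ω _ => mul_nonneg (hμ ω) (hF ω)) (by simp)

lemma sum_mul_sq_cexp_sub {μ : Finset V → ℝ} (hμ : ∀ ω, 0 ≤ μ ω) {U U' : Finset V}
    (hU : U ⊆ U') (F : Finset V → ℝ) :
    ∑ ω, μ ω * (cexp μ U' F ω - cexp μ U F ω) ^ 2 =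
      ∑ ω, μ ω * cexp μ U' F ω ^ 2 - ∑ ω, μ ω * cexp μ U F ω ^ 2 := by
  have hd := dependsOnlyOn_cexp μ U F
  have h1 := sum_mul_cexp hμ (hd.mono hU) F
  have h2 := sum_mul_cexp hμ hd F
  have h3 : ∀ ω, μ ω * (cexp μ U' F ω - cexp μ U F ω) ^ 2 =
      μ ω * cexp μ U' F ω ^ 2 - 2 * (μ ω * (cexp μ U F ω * cexp μ U' F ω)) +
        μ ω * cexp μ U F ω ^ 2 := fun ω => by ring
  simp_rw [h3]
  rw [Finset.sum_add_distrib, Finset.sum_sub_distrib, ← Finset.mul_sum, h1, ← h2]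
  simp_rw [← sq]
  ring

namespace NegativelyBiased

variable {μ : Finset V → ℝ} {p : ℝ}

lemma cexp_le (h : NegativelyBiased μ p) (hμ : ∀ ω, 0 ≤ μ ω) (hp : 0 ≤ p) {U : Finset V} {v : V}
    (hv : v ∉ U) (ω : Finset V) : cexp μ U (ind {v}) ω ≤ p := by
  refine div_le_of_le_mul₀ (Finset.sum_nonneg fun ω _ => hμ ω) hp ?_
  have := h v (fun ω' => if ω' ∩ U = ω ∩ U then 1 else 0)
    (fun ω' => by split_ifs <;> norm_num)
    (fun ω' _ => by rw [Finset.insert_inter_of_notMem hv])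
  simpa [Finset.sum_filter] using this

lemma sum_mul_ind_le (h : NegativelyBiased μ p) (hμ1 : ∑ ω, μ ω = 1) (hp : 0 ≤ p)
    (S : Finset V) : ∑ ω, μ ω * ind S ω ≤ p ^ S.card := by
  induction S using Finset.induction_on with
  | empty => simp [ind_empty, hμ1]
  | insert v S hv ih =>
    rw [Finset.card_insert_of_notMem hv, pow_succ']
    refine le_trans ?_ (mul_le_mul_of_nonneg_left ih hp)
    have := h v (ind S) (ind_nonneg S) (fun ω _ => by
      simp only [ind, Finset.subset_insert_iff_of_notMem hv, le_refl])
    simpa only [mul_assoc, ind_mul_ind_singleton] using this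

end NegativelyBiased

lemma negativelyBiased_of_lowerSet {A : Finset V → Prop}
    (hA : ∀ v ω, A (insert v ω) → A ω) {p Z : ℝ} (hp0 : 0 ≤ p) (hp1 : p ≤ 1) (hZ : 0 ≤ Z) :
    NegativelyBiased (fun ω => if A ω then pw (fun _ : V => p) ω / Z else 0) p := by
  intro v h h0 hanti
  set g : Finset V → ℝ := fun ω => (if A ω then pw (fun _ : V => p) ω / Z else 0) * h ω with hg
  have hsplit : ∀ F : Finset V → ℝ, ∑ ω, F ω =
      ∑ ω ∈ (Finset.univ.erase v).powerset, (F ω + F (insert v ω)) := by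
    intro F
    rw [Finset.sum_add_distrib, ← Finset.sum_powerset_insert (Finset.notMem_erase v _),
      Finset.insert_erase (Finset.mem_univ v), Finset.powerset_univ]
  have hkey : ∀ ω, v ∉ ω → (1 - p) * g (insert v ω) ≤ p * g ω := by
    intro ω hv
    have hpw : (1 - p) * pw (fun _ : V => p) (insert v ω) = p * pw (fun _ : V => p) ω := by
      unfold pw
      have : ωᶜ = insert v (insert v ω)ᶜ := by
        ext u; by_cases hu : u = v <;> simp [hu, hv]
      rw [this, Finset.prod_insert hv, Finset.prod_insert (by simp)]
      ring
    have hnn := pw_nonneg (q := fun _ : V => p) (fun _ => ⟨hp0, hp1⟩) ω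
    simp only [hg]
    by_cases h1 : A (insert v ω)
    · rw [if_pos h1, if_pos (hA v ω h1)]
      calc _ = ((1 - p) * pw (fun _ : V => p) (insert v ω)) / Z * h (insert v ω) := by ring
        _ = p * pw (fun _ : V => p) ω / Z * h (insert v ω) := by rw [hpw]
        _ ≤ p * pw (fun _ : V => p) ω / Z * h ω := by
          gcongr
          exact hanti ω hv
        _ = _ := by ring
    · rw [if_neg h1]
      split_ifs
      · simp only [zero_mul, mul_zero]
        have := h0 ω
        positivity
      · simp
  change ∑ ω, g ω * ind {v} ω ≤ p * ∑ ω, g ω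
  rw [hsplit, hsplit, Finset.mul_sum]
  refine Finset.sum_le_sum fun ω hω => ?_
  have hv : v ∉ ω := fun hv => by simpa using Finset.mem_powerset.1 hω hv
  have := hkey ω hv
  simp only [ind, Finset.singleton_subset_iff, hv, Finset.mem_insert_self, if_true, if_false]
  linarith

/-- The conditional covariance of the indicators of `S` and `{v}` given the restriction
to `U`. -/
def condCov (μ : Finset V → ℝ) (U S : Finset V) (v : V) (ω : Finset V) : ℝ :=
  cexp μ U (ind (insert v S)) ω - cexp μ U (ind S) ω * cexp μ U (ind {v}) ω

/-- The second moment of the conditional probability of `v` given the restriction to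
`U \ {v}`. -/
def energy (μ : Finset V → ℝ) (U : Finset V) (v : V) : ℝ :=
  ∑ ω, μ ω * cexp μ (U.erase v) (ind {v}) ω ^ 2

lemma dependsOnlyOn_condCov (μ : Finset V → ℝ) (U S : Finset V) (v : V) :
    DependsOnlyOn U (condCov μ U S v) := fun ω ω' h => by
  unfold condCov
  rw [dependsOnlyOn_cexp μ U _ ω ω' h, dependsOnlyOn_cexp μ U (ind S) ω ω' h,
    dependsOnlyOn_cexp μ U (ind {v}) ω ω' h]

lemma energy_mono {μ : Finset V → ℝ} (hμ : ∀ ω, 0 ≤ μ ω) {U U' : Finset V} (hU : U ⊆ U')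
    (v : V) : energy μ U v ≤ energy μ U' v := by
  have h := sum_mul_sq_cexp_sub hμ (Finset.erase_subset_erase v hU) (ind {v})
  rw [← sub_nonneg]
  unfold energy
  rw [← h]
  exact Finset.sum_nonneg fun ω _ => mul_nonneg (hμ ω) (sq_nonneg _)

lemma energy_nonneg {μ : Finset V → ℝ} (hμ : ∀ ω, 0 ≤ μ ω) (U : Finset V) (v : V) :
    0 ≤ energy μ U v :=
  Finset.sum_nonneg fun ω _ => mul_nonneg (hμ ω) (sq_nonneg _)

lemma energy_le {μ : Finset V → ℝ} {p : ℝ} (hμ : ∀ ω, 0 ≤ μ ω) (hμ1 : ∑ ω, μ ω = 1)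
    (hp : 0 ≤ p) (h : NegativelyBiased μ p) (U : Finset V) (v : V) : energy μ U v ≤ p ^ 2 := by
  calc energy μ U v ≤ ∑ ω, μ ω * p ^ 2 :=
        Finset.sum_le_sum fun ω _ => mul_le_mul_of_nonneg_left
          (pow_le_pow_left₀ (cexp_nonneg hμ _ (ind_nonneg _) ω)
            (h.cexp_le hμ hp (Finset.notMem_erase v U) ω) 2) (hμ ω)
    _ = p ^ 2 := by rw [← Finset.sum_mul, hμ1, one_mul]

lemma sum_sign_condCov_mul {μ : Finset V → ℝ} (hμ : ∀ ω, 0 ≤ μ ω) {U U' S : Finset V}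
    (hU : U ⊆ U') (hS : S ⊆ U') (v : V) :
    ∑ ω, μ ω * ((SignType.sign (condCov μ U S v ω) * ind S ω) *
      (cexp μ U' (ind {v}) ω - cexp μ U (ind {v}) ω)) = ∑ ω, μ ω * |condCov μ U S v ω| := by
  set σ : Finset V → ℝ := fun ω => SignType.sign (condCov μ U S v ω) with hσ
  have hσU : DependsOnlyOn U σ := fun ω ω' h => by
    simp only [hσ, dependsOnlyOn_condCov μ U S v ω ω' h]
  have h1 := sum_mul_cexp hμ ((hσU.mono hU).mul (dependsOnlyOn_ind hS)) (ind {v})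
  have h2 := sum_mul_cexp hμ hσU (ind (insert v S))
  have h3 := sum_mul_cexp hμ (hσU.mul (dependsOnlyOn_cexp μ U (ind {v}))) (ind S)
  simp only [mul_assoc, ind_mul_ind_singleton] at h1 h2 h3
  have h4 : ∀ ω, |condCov μ U S v ω| = σ ω * condCov μ U S v ω := fun ω =>
    (sign_mul_self _).symm
  change ∑ ω, μ ω * (σ ω * ind S ω * _) = _
  simp_rw [h4, condCov, mul_sub]
  rw [Finset.sum_sub_distrib, Finset.sum_sub_distrib, h2, ← h1]
  congr 1
  · exact Finset.sum_congr rfl fun ω _ => by ring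
  · calc _ = ∑ ω, μ ω * (σ ω * (cexp μ U (ind {v}) ω * ind S ω)) :=
          Finset.sum_congr rfl fun ω _ => by ring
      _ = _ := by
          rw [← h3]
          exact Finset.sum_congr rfl fun ω _ => by ring

lemma sum_ind_mul_condCov_le {μ : Finset V → ℝ} {p : ℝ} (hμ : ∀ ω, 0 ≤ μ ω)
    (hμ1 : ∑ ω, μ ω = 1) (hp : 0 ≤ p) (h : NegativelyBiased μ p) {U : Finset V} {v : V}
    (hv : v ∉ U) {𝒮 : Finset (Finset V)} (h𝒮 : ∀ S ∈ 𝒮, v ∉ S) {w : Finset V → ℝ}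
    (hw : ∀ S, 0 ≤ w S) {a : ℝ} (ha : 0 < a) (W : Finset V) :
    ∑ S ∈ 𝒮, ind S W * (w S * ∑ ω, μ ω * |condCov μ U S v ω|) ≤
      a / 2 * (energy μ (U ∪ W) v - energy μ U v) +
        1 / (2 * a) * ∑ S ∈ 𝒮, ∑ S' ∈ 𝒮,
          ind (S ∪ S') W * (w S * w S' * p ^ (S ∪ S').card) := by
  set U' := (U ∪ W).erase v with hU'
  have hUU' : U ⊆ U' := fun u hu =>
    Finset.mem_erase.2 ⟨fun h => hv (h ▸ hu), Finset.mem_union_left _ hu⟩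
  set Z : Finset V → ℝ := fun ω => cexp μ U' (ind {v}) ω - cexp μ U (ind {v}) ω with hZ
  set T : Finset V → ℝ := fun ω => ∑ S ∈ 𝒮,
    ind S W * w S * (SignType.sign (condCov μ U S v ω) * ind S ω) with hT
  have hZT : ∑ S ∈ 𝒮, ind S W * (w S * ∑ ω, μ ω * |condCov μ U S v ω|) =
      ∑ ω, μ ω * (Z ω * T ω) := by
    simp_rw [hT, Finset.mul_sum]
    rw [Finset.sum_comm (s := Finset.univ)]
    refine Finset.sum_congr rfl fun S hS => ?_
    by_cases hSW : S ⊆ W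
    · have hSU' : S ⊆ U' := fun u hu =>
        Finset.mem_erase.2 ⟨fun h => h𝒮 S hS (h ▸ hu), Finset.mem_union_right _ (hSW hu)⟩
      have key := sum_sign_condCov_mul hμ hUU' hSU' v
      rw [← Finset.mul_sum, ← Finset.mul_sum, ← key, Finset.mul_sum, Finset.mul_sum]
      exact Finset.sum_congr rfl fun ω _ => by ring
    · simp [ind, hSW]
  have hZ2 : ∑ ω, μ ω * Z ω ^ 2 = energy μ (U ∪ W) v - energy μ U v := by
    rw [hZ, sum_mul_sq_cexp_sub hμ hUU']
    unfold energy
    rw [Finset.erase_eq_of_notMem hv]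
  have hT2 : ∑ ω, μ ω * T ω ^ 2 ≤ ∑ S ∈ 𝒮, ∑ S' ∈ 𝒮,
      ind (S ∪ S') W * (w S * w S' * p ^ (S ∪ S').card) := by
    have h1 : ∀ ω, T ω ^ 2 ≤ ∑ S ∈ 𝒮, ∑ S' ∈ 𝒮,
        ind (S ∪ S') W * (w S * w S') * ind (S ∪ S') ω := by
      intro ω
      rw [sq, hT, Finset.sum_mul_sum]
      refine Finset.sum_le_sum fun S _ => Finset.sum_le_sum fun S' _ => ?_
      rw [← ind_mul_ind S S' W, ← ind_mul_ind S S' ω]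
      have hs : ∀ x y : SignType, (x : ℝ) * (y : ℝ) ≤ 1 := by
        intro x y
        cases x <;> cases y <;> norm_num
      calc _ = (ind S W * ind S' W * (w S * w S') * (ind S ω * ind S' ω)) *
            ((SignType.sign (condCov μ U S v ω) : ℝ) *
              (SignType.sign (condCov μ U S' v ω) : ℝ)) := by ring
        _ ≤ (ind S W * ind S' W * (w S * w S') * (ind S ω * ind S' ω)) * 1 := by
          refine mul_le_mul_of_nonneg_left (hs _ _) ?_
          have := ind_nonneg S W
          have := ind_nonneg S' W
          have := ind_nonneg S ω
          have := ind_nonneg S' ω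
          have := hw S
          have := hw S'
          positivity
        _ = _ := mul_one _
    calc _ ≤ ∑ ω, μ ω * ∑ S ∈ 𝒮, ∑ S' ∈ 𝒮,
          ind (S ∪ S') W * (w S * w S') * ind (S ∪ S') ω :=
          Finset.sum_le_sum fun ω _ => mul_le_mul_of_nonneg_left (h1 ω) (hμ ω)
      _ = ∑ S ∈ 𝒮, ∑ S' ∈ 𝒮,
          ind (S ∪ S') W * (w S * w S') * ∑ ω, μ ω * ind (S ∪ S') ω := by
        simp_rw [Finset.mul_sum]
        rw [Finset.sum_comm]
        refine Finset.sum_congr rfl fun S _ => ?_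
        rw [Finset.sum_comm]
        exact Finset.sum_congr rfl fun S' _ => Finset.sum_congr rfl fun ω _ => by ring
      _ ≤ _ := by
        refine Finset.sum_le_sum fun S _ => Finset.sum_le_sum fun S' _ => ?_
        rw [← mul_assoc (ind (S ∪ S') W) (w S * w S') (p ^ (S ∪ S').card)]
        exact mul_le_mul_of_nonneg_left (h.sum_mul_ind_le hμ1 hp (S ∪ S'))
          (mul_nonneg (ind_nonneg (S ∪ S') W) (mul_nonneg (hw S) (hw S')))
  rw [hZT, ← hZ2]
  calc _ ≤ ∑ ω, (a / 2 * (μ ω * Z ω ^ 2) + 1 / (2 * a) * (μ ω * T ω ^ 2)) := by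
        refine Finset.sum_le_sum fun ω _ => ?_
        have : Z ω * T ω ≤ a / 2 * Z ω ^ 2 + 1 / (2 * a) * T ω ^ 2 := by
          have h0 : 0 ≤ (a * Z ω - T ω) ^ 2 / (2 * a) := by positivity
          have h1 : (a * Z ω - T ω) ^ 2 / (2 * a) =
              a / 2 * Z ω ^ 2 + 1 / (2 * a) * T ω ^ 2 - Z ω * T ω := by
            field_simp; ring
          linarith
        nlinarith [mul_le_mul_of_nonneg_left this (hμ ω)]
    _ = a / 2 * ∑ ω, μ ω * Z ω ^ 2 + 1 / (2 * a) * ∑ ω, μ ω * T ω ^ 2 := by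
        rw [Finset.sum_add_distrib, Finset.mul_sum, Finset.mul_sum]
    _ ≤ _ := by gcongr

lemma sum_pow_mul_condCov_le {μ : Finset V → ℝ} {p t : ℝ} (hμ : ∀ ω, 0 ≤ μ ω)
    (hμ1 : ∑ ω, μ ω = 1) (hp : 0 ≤ p) (h : NegativelyBiased μ p) (ht : t ∈ Set.Icc (0 : ℝ) 1)
    {U : Finset V} {v : V}
    (hv : v ∉ U) {𝒮 : Finset (Finset V)} (h𝒮 : ∀ S ∈ 𝒮, v ∉ S) {w : Finset V → ℝ}
    (hw : ∀ S, 0 ≤ w S) {a : ℝ} (ha : 0 < a) :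
    ∑ S ∈ 𝒮, t ^ S.card * (w S * ∑ ω, μ ω * |condCov μ U S v ω|) ≤
      a / 2 * ∑ W, pw (fun _ : V => t) W * (energy μ (U ∪ W) v - energy μ U v) +
        1 / (2 * a) * ∑ S ∈ 𝒮, ∑ S' ∈ 𝒮, w S * w S' * (t * p) ^ (S ∪ S').card := by
  have hmom : ∀ S : Finset V, ∑ W : Finset V, pw (fun _ : V => t) W * ind S W = t ^ S.card := fun S => by
    rw [sum_pw_mul_ind, Finset.prod_const]
  have h1 := Finset.sum_le_sum fun (W : Finset V) (_ : W ∈ (Finset.univ : Finset (Finset V))) =>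
    mul_le_mul_of_nonneg_left (sum_ind_mul_condCov_le hμ hμ1 hp h hv h𝒮 hw ha W)
      (pw_nonneg (q := fun _ : V => t) (fun _ => ht) W)
  calc _ = ∑ W, pw (fun _ : V => t) W *
        ∑ S ∈ 𝒮, ind S W * (w S * ∑ ω, μ ω * |condCov μ U S v ω|) := by
        simp_rw [Finset.mul_sum (s := 𝒮)]
        rw [Finset.sum_comm]
        refine Finset.sum_congr rfl fun S _ => ?_
        rw [← hmom, Finset.sum_mul]
        exact Finset.sum_congr rfl fun W _ => by ring
    _ ≤ _ := h1
    _ = _ := by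
        simp_rw [mul_add]
        rw [Finset.sum_add_distrib, Finset.mul_sum]
        congr 1
        · exact Finset.sum_congr rfl fun W _ => by ring
        · simp_rw [Finset.mul_sum]
          rw [Finset.sum_comm]
          refine Finset.sum_congr rfl fun S _ => ?_
          rw [Finset.sum_comm]
          refine Finset.sum_congr rfl fun S' _ => ?_
          rw [mul_pow, ← hmom, Finset.sum_mul, Finset.mul_sum, Finset.mul_sum]
          exact Finset.sum_congr rfl fun W _ => by ring

/-- The total weight of the sets containing `B`. -/
def codeg (c : Finset V → ℝ) (B : Finset V) : ℝ := ∑ e with B ⊆ e, c e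

lemma codeg_nonneg {c : Finset V → ℝ} (hc : ∀ e, 0 ≤ c e) (B : Finset V) : 0 ≤ codeg c B :=
  Finset.sum_nonneg fun e _ => hc e

lemma codeg_eq_zero {c : Finset V → ℝ} {r : ℕ} (hr : ∀ e, c e ≠ 0 → e.card = r) {B : Finset V}
    (hB : r < B.card) : codeg c B = 0 :=
  Finset.sum_eq_zero fun e he => by
    by_contra h
    have := Finset.card_le_card (Finset.mem_filter.1 he).2
    rw [hr e h] at this
    omega

lemma sum_codeg_insert_le {c : Finset V → ℝ} {r : ℕ} (hc : ∀ e, 0 ≤ c e)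
    (hr : ∀ e, c e ≠ 0 → e.card = r) (𝒮 : Finset (Finset V)) (B : Finset V) (v : V) :
    ∑ S ∈ 𝒮 with B ⊆ S, codeg c (insert v S) ≤ 2 ^ r * codeg c (insert v B) := by
  simp only [codeg, Finset.sum_filter (s := Finset.univ), Finset.mul_sum]
  rw [Finset.sum_comm]
  refine Finset.sum_le_sum fun e _ => ?_
  rw [← Finset.sum_filter, Finset.sum_const, nsmul_eq_mul]
  rcases (hc e).eq_or_lt with h0 | h0
  · simp [← h0]
  by_cases hB : insert v B ⊆ e
  · rw [if_pos hB]
    gcongr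
    rw [← hr e h0.ne']
    have : (Finset.filter (fun S => insert v S ⊆ e) (𝒮.filter (B ⊆ ·))) ⊆ e.powerset :=
      fun S hS => Finset.mem_powerset.2
        ((Finset.subset_insert _ _).trans (Finset.mem_filter.1 hS).2)
    have := Finset.card_le_card this
    rw [Finset.card_powerset] at this
    exact_mod_cast this
  · rw [if_neg hB, Finset.filter_false_of_mem, Finset.card_empty]
    · simp
    · intro S hS hS'
      exact hB ((Finset.insert_subset_insert v (Finset.mem_filter.1 hS).2).trans hS')

lemma sum_sum_codeg_le {c : Finset V → ℝ} {r : ℕ} {θ L : ℝ} (hc : ∀ e, 0 ≤ c e)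
    (hr : ∀ e, c e ≠ 0 → e.card = r) (hθ : 0 < θ) (hL : 0 ≤ L)
    (hd : ∀ B : Finset V, B.Nonempty → codeg c B ≤ L * θ ^ (B.card - 1))
    {𝒮 : Finset (Finset V)} {v : V} (h𝒮 : ∀ S ∈ 𝒮, v ∉ S) :
    ∑ S ∈ 𝒮, ∑ S' ∈ 𝒮, (codeg c (insert v S) * (θ ^ S.card)⁻¹) *
      (codeg c (insert v S') * (θ ^ S'.card)⁻¹) * θ ^ (S ∪ S').card ≤ (4 ^ r * L) ^ 2 := by
  have hstep : ∀ S ∈ 𝒮, ∀ B ∈ S.powerset,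
      (θ ^ B.card)⁻¹ * ∑ S' ∈ 𝒮 with B ⊆ S', codeg c (insert v S') ≤ 2 ^ r * L := by
    intro S hS B hB
    have hvB : v ∉ B := fun h => h𝒮 S hS (Finset.mem_powerset.1 hB h)
    have h1 := sum_codeg_insert_le hc hr 𝒮 B v
    have h2 := hd (insert v B) (Finset.insert_nonempty v B)
    rw [Finset.card_insert_of_notMem hvB, Nat.add_sub_cancel] at h2
    rw [inv_mul_le_iff₀ (by positivity)]
    calc _ ≤ _ := h1
      _ ≤ 2 ^ r * (L * θ ^ B.card) := by gcongr
      _ = _ := by ring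
  have hS1 : ∀ S ∈ 𝒮, ∑ S' ∈ 𝒮, (codeg c (insert v S) * (θ ^ S.card)⁻¹) *
      (codeg c (insert v S') * (θ ^ S'.card)⁻¹) * θ ^ (S ∪ S').card ≤
        codeg c (insert v S) * (4 ^ r * L) := by
    intro S hS
    by_cases hcard : r < (insert v S).card
    · simp [codeg_eq_zero hr hcard]
    calc _ = codeg c (insert v S) * ∑ S' ∈ 𝒮, codeg c (insert v S') *
          ((θ ^ S.card)⁻¹ * (θ ^ S'.card)⁻¹ * θ ^ (S ∪ S').card) := by
          rw [Finset.mul_sum]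
          exact Finset.sum_congr rfl fun S' _ => by ring
      _ ≤ codeg c (insert v S) * ∑ S' ∈ 𝒮, codeg c (insert v S') *
          ∑ B ∈ S.powerset with B ⊆ S', (θ ^ B.card)⁻¹ := by
          refine mul_le_mul_of_nonneg_left (Finset.sum_le_sum fun S' _ => ?_)
            (codeg_nonneg hc _)
          exact mul_le_mul_of_nonneg_left (inv_pow_card_mul_le hθ S S') (codeg_nonneg hc _)
      _ = codeg c (insert v S) * ∑ B ∈ S.powerset, (θ ^ B.card)⁻¹ *
          ∑ S' ∈ 𝒮 with B ⊆ S', codeg c (insert v S') := by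
          congr 1
          simp_rw [Finset.mul_sum, Finset.sum_filter]
          rw [Finset.sum_comm]
          exact Finset.sum_congr rfl fun B _ => Finset.sum_congr rfl fun S' _ => by
            split_ifs <;> ring
      _ ≤ codeg c (insert v S) * ∑ B ∈ S.powerset, 2 ^ r * L :=
          mul_le_mul_of_nonneg_left (Finset.sum_le_sum (hstep S hS)) (codeg_nonneg hc _)
      _ = codeg c (insert v S) * (2 ^ S.card * (2 ^ r * L)) := by
          rw [Finset.sum_const, Finset.card_powerset, nsmul_eq_mul]; push_cast; rfl
      _ ≤ codeg c (insert v S) * (2 ^ r * (2 ^ r * L)) := by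
          have := Finset.card_le_card (Finset.subset_insert v S)
          have := codeg_nonneg hc (insert v S)
          gcongr
          · norm_num
          · omega
      _ = _ := by rw [← mul_assoc (2 ^ r : ℝ), ← mul_pow]; norm_num
  have hsum : ∑ S ∈ 𝒮, codeg c (insert v S) ≤ 2 ^ r * L := by
    have h1 := sum_codeg_insert_le hc hr 𝒮 ∅ v
    have h2 := hd {v} (Finset.singleton_nonempty v)
    simp only [Finset.empty_subset, Finset.filter_true, insert_empty_eq] at h1
    simp only [Finset.card_singleton, Nat.sub_self, pow_zero, mul_one] at h2
    exact h1.trans (by gcongr)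
  calc _ ≤ ∑ S ∈ 𝒮, codeg c (insert v S) * (4 ^ r * L) := Finset.sum_le_sum hS1
    _ = (∑ S ∈ 𝒮, codeg c (insert v S)) * (4 ^ r * L) := by rw [Finset.sum_mul]
    _ ≤ (2 ^ r * L) * (4 ^ r * L) := by gcongr
    _ ≤ (4 ^ r * L) * (4 ^ r * L) := by gcongr; norm_num
    _ = _ := by ring

lemma exists_pinning {μ : Finset V → ℝ} {p δ : ℝ} (hμ : ∀ ω, 0 ≤ μ ω) (hμ1 : ∑ ω, μ ω = 1)
    (hp : 0 < p) (h : NegativelyBiased μ p) (hδ : 0 < δ) :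
    ∃ U : Finset V, (U.card : ℝ) ≤ δ * Fintype.card V ∧
      ∀ W, ∑ v, (energy μ (U ∪ W) v - energy μ U v) ≤ p ^ 2 / δ * W.card := by
  obtain ⟨U, hU⟩ := Finite.exists_max
    (fun U : Finset V => ∑ v, energy μ U v - p ^ 2 / δ * U.card)
  refine ⟨U, ?_, fun W => ?_⟩
  · have h1 := hU ∅
    have h2 : ∑ v, energy μ U v ≤ Fintype.card V * p ^ 2 := by
      refine (Finset.sum_le_sum fun v _ => energy_le hμ hμ1 hp.le h U v).trans ?_
      simp
    have h3 : 0 ≤ ∑ v, energy μ ∅ v := Finset.sum_nonneg fun v _ => energy_nonneg hμ ∅ v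
    simp only [Finset.card_empty, Nat.cast_zero, mul_zero, sub_zero] at h1
    have h4 : p ^ 2 / δ * U.card ≤ Fintype.card V * p ^ 2 := by linarith
    have h5 : p ^ 2 * (U.card : ℝ) ≤ p ^ 2 * (δ * Fintype.card V) := by
      rw [div_mul_eq_mul_div, div_le_iff₀ hδ] at h4
      linarith
    exact le_of_mul_le_mul_left h5 (by positivity)
  · have h1 := hU (U ∪ W)
    have h2 : ((U ∪ W).card : ℝ) ≤ U.card + W.card := by
      exact_mod_cast Finset.card_union_le U W
    have h3 : p ^ 2 / δ * ((U ∪ W).card : ℝ) ≤ p ^ 2 / δ * (U.card + W.card) := by gcongr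
    rw [Finset.sum_sub_distrib]
    linarith

lemma sum_codeg_mul_condCov_le {μ : Finset V → ℝ} {p δ γ L : ℝ} {r : ℕ} {c : Finset V → ℝ}
    {U : Finset V} (hμ : ∀ ω, 0 ≤ μ ω) (hμ1 : ∑ ω, μ ω = 1)
    (hp : 0 < p) (h : NegativelyBiased μ p) (hδ : 0 < δ) (hγ : 0 < γ) (hδγ : δ * γ ^ 2 ≤ 1)
    (hc : ∀ e, 0 ≤ c e) (hr : ∀ e, c e ≠ 0 → e.card = r) (hL : 0 < L)
    (hd : ∀ B : Finset V, B.Nonempty → codeg c B ≤ L * (δ * γ ^ 2 * p) ^ (B.card - 1))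
    (hU : ∀ W, ∑ v, (energy μ (U ∪ W) v - energy μ U v) ≤ p ^ 2 / δ * W.card) :
    ∑ v ∈ Uᶜ, ∑ S ∈ ((insert v U)ᶜ).powerset,
      codeg c (insert v S) * (p ^ S.card)⁻¹ * ∑ ω, μ ω * |condCov μ U S v ω| ≤
        γ * (4 ^ r * L) * p * Fintype.card V := by
  set t := δ * γ ^ 2 with ht
  have ht0 : 0 < t := by positivity
  set a := 4 ^ r * L / (p * γ) with ha
  have ha0 : 0 < a := by positivity
  have hv : ∀ v ∈ Uᶜ, ∑ S ∈ ((insert v U)ᶜ).powerset,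
      codeg c (insert v S) * (p ^ S.card)⁻¹ * ∑ ω, μ ω * |condCov μ U S v ω| ≤
        a / 2 * ∑ W, pw (fun _ : V => t) W * (energy μ (U ∪ W) v - energy μ U v) +
          1 / (2 * a) * (4 ^ r * L) ^ 2 := by
    intro v hv
    have h𝒮 : ∀ S ∈ ((insert v U)ᶜ).powerset, v ∉ S := fun S hS hvS => by
      simpa using Finset.mem_powerset.1 hS hvS
    have h1 := sum_pow_mul_condCov_le hμ hμ1 hp.le h ⟨ht0.le, hδγ⟩ (Finset.mem_compl.1 hv) h𝒮
      (w := fun S => codeg c (insert v S) * ((t * p) ^ S.card)⁻¹)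
      (fun S => mul_nonneg (codeg_nonneg hc _) (by positivity)) ha0
    have h2 := sum_sum_codeg_le hc hr (mul_pos ht0 hp) hL.le hd h𝒮
    calc _ = ∑ S ∈ ((insert v U)ᶜ).powerset, t ^ S.card *
          (codeg c (insert v S) * ((t * p) ^ S.card)⁻¹ *
            ∑ ω, μ ω * |condCov μ U S v ω|) := by
          refine Finset.sum_congr rfl fun S _ => ?_
          rw [mul_pow t p, mul_inv]
          have : t ^ S.card ≠ 0 := by positivity
          field_simp
      _ ≤ _ := h1
      _ ≤ _ := by gcongr
  have hmono : ∀ (W : Finset V) v, 0 ≤ energy μ (U ∪ W) v - energy μ U v := fun W v =>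
    sub_nonneg.2 (energy_mono hμ Finset.subset_union_left v)
  have hpw : ∀ W : Finset V, 0 ≤ pw (fun _ : V => t) W :=
    pw_nonneg (q := fun _ : V => t) (fun _ => ⟨ht0.le, hδγ⟩)
  calc _ ≤ ∑ v ∈ Uᶜ, (a / 2 * ∑ W, pw (fun _ : V => t) W *
          (energy μ (U ∪ W) v - energy μ U v) + 1 / (2 * a) * (4 ^ r * L) ^ 2) :=
        Finset.sum_le_sum hv
    _ ≤ ∑ v, (a / 2 * ∑ W, pw (fun _ : V => t) W *
          (energy μ (U ∪ W) v - energy μ U v) + 1 / (2 * a) * (4 ^ r * L) ^ 2) := by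
        refine Finset.sum_le_sum_of_subset_of_nonneg (Finset.subset_univ _) fun v _ _ => ?_
        have : 0 ≤ ∑ W, pw (fun _ : V => t) W * (energy μ (U ∪ W) v - energy μ U v) :=
          Finset.sum_nonneg fun W _ => mul_nonneg (hpw W) (hmono W v)
        positivity
    _ = a / 2 * ∑ W, pw (fun _ : V => t) W * ∑ v, (energy μ (U ∪ W) v - energy μ U v) +
          Fintype.card V * (1 / (2 * a) * (4 ^ r * L) ^ 2) := by
        rw [Finset.sum_add_distrib, Finset.sum_const, Finset.card_univ, nsmul_eq_mul,
          ← Finset.mul_sum, Finset.sum_comm]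
        simp_rw [Finset.mul_sum]
    _ ≤ a / 2 * ∑ W, pw (fun _ : V => t) W * (p ^ 2 / δ * (W.card : ℝ)) +
          Fintype.card V * (1 / (2 * a) * (4 ^ r * L) ^ 2) := by
        gcongr with W _
        · exact hpw W
        · exact hU W
    _ = a / 2 * (p ^ 2 / δ * (t * Fintype.card V)) +
          Fintype.card V * (1 / (2 * a) * (4 ^ r * L) ^ 2) := by
        rw [← sum_pw_mul_card, Finset.mul_sum (a := p ^ 2 / δ)]
        congr 2
        exact Finset.sum_congr rfl fun W _ => by ring
    _ = _ := by
        rw [ha, ht]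
        field_simp
        ring

lemma abs_prod_cexp_sub_le {μ : Finset V → ℝ} {p : ℝ} (hμ : ∀ ω, 0 ≤ μ ω)
    (hp : 0 < p) (h : NegativelyBiased μ p) {U e : Finset V} (he : Disjoint e U) {ω : Finset V}
    (hω : 0 < μ ω) :
    |∏ v ∈ e, cexp μ U (ind {v}) ω - cexp μ U (ind e) ω| ≤
      p ^ e.card * ∑ v ∈ e, ∑ S ∈ (e.erase v).powerset,
        (p ^ (S.card + 1))⁻¹ * |condCov μ U S v ω| := by
  induction e using Finset.induction_on with
  | empty => simp [cexp_one hμ U hω]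
  | insert v e hv ih =>
    rw [Finset.disjoint_insert_left] at he
    have hq0 := cexp_nonneg hμ U (ind_nonneg {v}) ω
    have hq1 := h.cexp_le hμ hp.le he.1 ω
    have hg : ∀ u S, 0 ≤ (p ^ (Finset.card S + 1))⁻¹ * |condCov μ U S u ω| := fun u S => by
      positivity
    have h1 : ∏ u ∈ insert v e, cexp μ U (ind {u}) ω - cexp μ U (ind (insert v e)) ω =
        cexp μ U (ind {v}) ω * (∏ u ∈ e, cexp μ U (ind {u}) ω - cexp μ U (ind e) ω) -
          condCov μ U e v ω := by
      rw [Finset.prod_insert hv, condCov]; ring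
    have h2 : ∑ u ∈ e, ∑ S ∈ (e.erase u).powerset,
        (p ^ (S.card + 1))⁻¹ * |condCov μ U S u ω| ≤
        ∑ u ∈ e, ∑ S ∈ ((insert v e).erase u).powerset,
        (p ^ (S.card + 1))⁻¹ * |condCov μ U S u ω| :=
      Finset.sum_le_sum fun u _ => Finset.sum_le_sum_of_subset_of_nonneg
        (Finset.powerset_mono.2 (Finset.erase_subset_erase u (Finset.subset_insert v e)))
        fun S _ _ => hg u S
    have h3 : (p ^ (e.card + 1))⁻¹ * |condCov μ U e v ω| ≤
        ∑ S ∈ ((insert v e).erase v).powerset, (p ^ (S.card + 1))⁻¹ * |condCov μ U S v ω| :=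
      Finset.single_le_sum (f := fun S => (p ^ (Finset.card S + 1))⁻¹ * |condCov μ U S v ω|)
        (fun S _ => hg v S) (by simp [Finset.erase_insert hv])
    rw [h1, Finset.card_insert_of_notMem hv, Finset.sum_insert hv, mul_add]
    calc _ ≤ |cexp μ U (ind {v}) ω *
            (∏ u ∈ e, cexp μ U (ind {u}) ω - cexp μ U (ind e) ω)| + |condCov μ U e v ω| :=
          abs_sub _ _
      _ ≤ p * (p ^ e.card * ∑ u ∈ e, ∑ S ∈ (e.erase u).powerset,
            (p ^ (S.card + 1))⁻¹ * |condCov μ U S u ω|) + |condCov μ U e v ω| := by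
          rw [abs_mul, abs_of_nonneg hq0]
          gcongr
          exact ih he.2
      _ = p ^ (e.card + 1) * ((p ^ (e.card + 1))⁻¹ * |condCov μ U e v ω|) +
            p ^ (e.card + 1) * ∑ u ∈ e, ∑ S ∈ (e.erase u).powerset,
            (p ^ (S.card + 1))⁻¹ * |condCov μ U S u ω| := by
          rw [mul_inv_cancel_left₀ (by positivity), pow_succ']
          ring
      _ ≤ _ := by gcongr

lemma sum_disjoint_le {c : Finset V → ℝ} (hc : ∀ e, 0 ≤ c e) (U : Finset V)
    {g : V → Finset V → ℝ} (hg : ∀ v S, 0 ≤ g v S) :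
    ∑ e with Disjoint e U, c e * ∑ v ∈ e, ∑ S ∈ (e.erase v).powerset, g v S ≤
      ∑ v ∈ Uᶜ, ∑ S ∈ ((insert v U)ᶜ).powerset, codeg c (insert v S) * g v S := by
  have h1 : ∀ e, Disjoint e U → ∑ v ∈ e, ∑ S ∈ (e.erase v).powerset, g v S ≤
      ∑ v ∈ Uᶜ, ∑ S ∈ ((insert v U)ᶜ).powerset, if insert v S ⊆ e then g v S else 0 := by
    intro e he
    have hnn : ∀ v S, 0 ≤ if insert v S ⊆ e then g v S else 0 := fun v S => by
      split_ifs
      · exact hg v S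
      · exact le_rfl
    have heU : e ⊆ Uᶜ := fun v hv => Finset.mem_compl.2 (Finset.disjoint_left.1 he hv)
    refine le_trans (Finset.sum_le_sum fun v hv => ?_)
      (Finset.sum_le_sum_of_subset_of_nonneg heU fun v _ _ =>
        Finset.sum_nonneg fun S _ => hnn v S)
    refine le_trans (le_of_eq ?_) (Finset.sum_le_sum_of_subset_of_nonneg
      (s := (e.erase v).powerset) ?_ fun S _ _ => hnn v S)
    · refine Finset.sum_congr rfl fun S hS => ?_
      rw [if_pos (Finset.insert_subset hv
        ((Finset.mem_powerset.1 hS).trans (Finset.erase_subset v e)))]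
    · refine Finset.powerset_mono.2 fun u hu => ?_
      have := Finset.mem_erase.1 hu
      have := Finset.mem_compl.1 (heU this.2)
      simp_all
  calc _ ≤ ∑ e with Disjoint e U, c e * ∑ v ∈ Uᶜ, ∑ S ∈ ((insert v U)ᶜ).powerset,
        (if insert v S ⊆ e then g v S else 0) := by
        refine Finset.sum_le_sum fun e he => ?_
        exact mul_le_mul_of_nonneg_left (h1 e (Finset.mem_filter.1 he).2) (hc e)
    _ ≤ ∑ e, c e * ∑ v ∈ Uᶜ, ∑ S ∈ ((insert v U)ᶜ).powerset,
        (if insert v S ⊆ e then g v S else 0) := by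
        refine Finset.sum_le_sum_of_subset_of_nonneg (Finset.filter_subset _ _) fun e _ _ => ?_
        refine mul_nonneg (hc e) (Finset.sum_nonneg fun v _ => Finset.sum_nonneg fun S _ => ?_)
        split_ifs
        · exact hg v S
        · exact le_rfl
    _ = _ := by
        simp_rw [Finset.mul_sum]
        rw [Finset.sum_comm]
        refine Finset.sum_congr rfl fun v _ => ?_
        rw [Finset.sum_comm]
        refine Finset.sum_congr rfl fun S _ => ?_
        rw [codeg, Finset.sum_filter, Finset.sum_mul]
        exact Finset.sum_congr rfl fun e _ => by split_ifs <;> ring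

lemma ip_nonneg {p q : ℝ} (hp0 : 0 < p) (hp1 : p < 1) (hq : q ∈ Set.Icc (0 : ℝ) 1) :
    0 ≤ ip p q := by
  have key : ∀ x y : ℝ, 0 ≤ x → 0 < y → x - y ≤ x * Real.log (x / y) := by
    intro x y hx hy
    rcases hx.eq_or_lt with rfl | hx
    · simp [hy.le]
    · have h := Real.one_sub_inv_le_log_of_pos (div_pos hx hy)
      have h2 := mul_le_mul_of_nonneg_left h hx.le
      have h3 : x * (1 - (x / y)⁻¹) = x - y := by field_simp
      linarith
  have h1 := key q p hq.1 hp0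
  have h2 := key (1 - q) (1 - p) (by linarith [hq.2]) (by linarith)
  unfold ip
  linarith

lemma ip_self (p : ℝ) : ip p p = 0 := by
  unfold ip
  have : ∀ x : ℝ, x * Real.log (x / x) = 0 := fun x => by
    by_cases hx : x = 0
    · simp [hx]
    · simp [div_self hx]
  rw [this, this, add_zero]

/-- The conditional probabilities given the restriction to `U`, reset to `p` on `U`. -/
def condProb (μ : Finset V → ℝ) (p : ℝ) (U ω : Finset V) (v : V) : ℝ :=
  if v ∈ U then p else cexp μ U (ind {v}) ω

lemma condProb_mem {μ : Finset V → ℝ} {p : ℝ} (hμ : ∀ ω, 0 ≤ μ ω) (hp : 0 ≤ p)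
    (h : NegativelyBiased μ p) (U ω : Finset V) (v : V) :
    condProb μ p U ω v ∈ Set.Icc 0 p := by
  unfold condProb
  split_ifs with hv
  · exact ⟨hp, le_rfl⟩
  · exact ⟨cexp_nonneg hμ U (ind_nonneg _) ω, h.cexp_le hμ hp hv ω⟩

lemma dependsOnlyOn_condProb (μ : Finset V → ℝ) (p : ℝ) (U : Finset V) (v : V) :
    DependsOnlyOn U (fun ω => condProb μ p U ω v) := fun ω ω' h => by
  simp only [condProb, dependsOnlyOn_cexp μ U (ind {v}) ω ω' h]

lemma sum_mul_sum_ip_condProb_le {μ : Finset V → ℝ} {p Z : ℝ} (hμ : ∀ ω, 0 ≤ μ ω)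
    (hμ1 : ∑ ω, μ ω = 1) (hp0 : 0 < p) (hp1 : p < 1) (h : NegativelyBiased μ p) (hZ : 0 < Z)
    (hμZ : ∀ ω, 0 < μ ω → pw (fun _ => p) ω = μ ω * Z) (U : Finset V) :
    ∑ ω, μ ω * ∑ v, ip p (condProb μ p U ω v) ≤ -Real.log Z := by
  set Q := condProb μ p U with hQ
  have hQmem : ∀ ω v, Q ω v ∈ Set.Icc 0 p := condProb_mem hμ hp0.le h U
  have hQdep : ∀ v, DependsOnlyOn U (fun ω => Q ω v) := dependsOnlyOn_condProb μ p U
  set ℓ : Finset V → V → ℝ := fun ω v =>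
    if v ∈ ω then Real.log (Q ω v / p) else Real.log ((1 - Q ω v) / (1 - p)) with hℓ
  have h1 : ∑ ω, μ ω * ∑ v, ip p (Q ω v) = ∑ ω, μ ω * ∑ v, ℓ ω v := by
    simp_rw [Finset.mul_sum]
    refine Finset.sum_comm.trans (Eq.trans ?_ Finset.sum_comm)
    refine Finset.sum_congr rfl fun v _ => ?_
    by_cases hv : v ∈ U
    · refine Finset.sum_congr rfl fun ω _ => ?_
      have hq : Q ω v = p := by simp [hQ, condProb, hv]
      simp only [hℓ, hq, ip_self, div_self hp0.ne', div_self (sub_pos.2 hp1).ne', Real.log_one,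
        ite_self]
    · have hq : ∀ ω, cexp μ U (ind {v}) ω = Q ω v := fun ω => by simp [hQ, condProb, hv]
      have hdep : DependsOnlyOn U (fun ω => Real.log (Q ω v / p) -
          Real.log ((1 - Q ω v) / (1 - p))) := fun ω ω' hω => by
        simp only [hQdep v ω ω' hω]
      have h2 := sum_mul_cexp hμ hdep (ind {v})
      simp only [hq] at h2
      have h3 : ∀ ω, μ ω * ip p (Q ω v) = μ ω * ((Real.log (Q ω v / p) -
          Real.log ((1 - Q ω v) / (1 - p))) * Q ω v) +
            μ ω * Real.log ((1 - Q ω v) / (1 - p)) := fun ω => by unfold ip; ring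
      have h4 : ∀ ω, μ ω * ℓ ω v = μ ω * ((Real.log (Q ω v / p) -
          Real.log ((1 - Q ω v) / (1 - p))) * ind {v} ω) +
            μ ω * Real.log ((1 - Q ω v) / (1 - p)) := fun ω => by
        simp only [hℓ, ind, Finset.singleton_subset_iff]
        split_ifs <;> ring
      simp_rw [h3, h4]
      rw [Finset.sum_add_distrib, Finset.sum_add_distrib, h2]
  have h2 : ∀ ω, μ ω * ∑ v, ℓ ω v ≤ pw (Q ω) ω - μ ω - μ ω * Real.log Z := by
    intro ω
    rcases (hμ ω).eq_or_lt with h0 | h0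
    · rw [← h0]
      have := pw_nonneg (q := Q ω) (fun v => ⟨(hQmem ω v).1, (hQmem ω v).2.trans hp1.le⟩) ω
      simpa using this
    have hpos : ∀ v ∈ ω, 0 < Q ω v := by
      intro v hv
      simp only [hQ, condProb]
      split_ifs
      · exact hp0
      · exact cexp_pos hμ U (ind_nonneg _) h0 (by simp [ind, hv])
    have hlt : ∀ v, Q ω v < 1 := fun v => (hQmem ω v).2.trans_lt hp1
    have hν : 0 < pw (Q ω) ω := pw_pos hpos fun v _ => hlt v
    have hsum : ∑ v, ℓ ω v = Real.log (pw (Q ω) ω / pw (fun _ => p) ω) := by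
      rw [pw_eq_prod, pw_eq_prod, ← Finset.prod_div_distrib, Real.log_prod]
      · refine Finset.sum_congr rfl fun v _ => ?_
        simp only [hℓ]
        split_ifs <;> rfl
      · intro v _
        have := hlt v
        split_ifs with hv
        · exact (div_pos (hpos v hv) hp0).ne'
        · exact (div_pos (by linarith) (by linarith)).ne'
    rw [hsum, hμZ ω h0, ← div_div, Real.log_div (by positivity) hZ.ne', mul_sub]
    have h5 := mul_le_mul_of_nonneg_left (Real.log_le_sub_one_of_pos (div_pos hν h0)) h0.le
    have h6 : μ ω * (pw (Q ω) ω / μ ω - 1) = pw (Q ω) ω - μ ω := by field_simp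
    linarith
  rw [h1]
  calc _ ≤ ∑ ω, (pw (Q ω) ω - μ ω - μ ω * Real.log Z) := Finset.sum_le_sum fun ω _ => h2 ω
    _ = _ := by
      rw [Finset.sum_sub_distrib, Finset.sum_sub_distrib, ← Finset.sum_mul, hμ1,
        sum_pw_of_dependsOnlyOn (p := fun _ => p) hQdep
          (fun ω v hv => by simp [hQ, condProb, hv])]
      ring

lemma sum_not_disjoint_le {c : Finset V → ℝ} (hc : ∀ e, 0 ≤ c e) (U : Finset V) :
    ∑ e with ¬ Disjoint e U, c e ≤ ∑ v ∈ U, codeg c {v} := by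
  simp only [codeg, Finset.sum_filter]
  rw [Finset.sum_comm]
  refine Finset.sum_le_sum fun e _ => ?_
  have hnn : ∀ v ∈ U, 0 ≤ if {v} ⊆ e then c e else 0 := fun v _ => by
    split_ifs
    · exact hc e
    · exact le_rfl
  split_ifs with h
  · exact Finset.sum_nonneg hnn
  · obtain ⟨v, hve, hvU⟩ := Finset.not_disjoint_iff.1 h
    refine le_trans ?_ (Finset.single_le_sum hnn hvU)
    rw [if_pos (Finset.singleton_subset_iff.2 hve)]

/-- The conditional probabilities almost satisfy the constraint, up to the error made by
replacing conditional joint probabilities by products. -/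
lemma sum_mul_prod_condProb_le {μ : Finset V → ℝ} {p b : ℝ} {r : ℕ} {c : Finset V → ℝ}
    (hμ : ∀ ω, 0 ≤ μ ω) (hp : 0 ≤ p) (h : NegativelyBiased μ p)
    (hc : ∀ e, 0 ≤ c e) (hr : ∀ e, c e ≠ 0 → e.card = r) (hb : 0 ≤ b)
    (hA : ∀ ω, 0 < μ ω → ∑ e, c e * ind e ω ≤ b) (U ω : Finset V) :
    ∑ e, c e * ∏ v ∈ e, condProb μ p U ω v ≤
      (∑ e with Disjoint e U,
        c e * |∏ v ∈ e, cexp μ U (ind {v}) ω - cexp μ U (ind e) ω|) + b +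
        p ^ r * ∑ v ∈ U, codeg c {v} := by
  rw [← Finset.sum_filter_add_sum_filter_not Finset.univ (fun e => Disjoint e U)]
  have hQ := condProb_mem hμ hp h U ω
  refine add_le_add ?_ ?_
  · have h1 : ∑ e with Disjoint e U, c e * cexp μ U (ind e) ω ≤ b := by
      refine le_trans (Finset.sum_le_sum_of_subset_of_nonneg (Finset.filter_subset _ _)
        fun e _ _ => mul_nonneg (hc e) (cexp_nonneg hμ U (ind_nonneg e) ω)) ?_
      rw [← cexp_sum_mul]
      exact cexp_le_const hμ U hb hA ω
    refine le_trans ?_ (add_le_add_right h1 _)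
    rw [← Finset.sum_add_distrib]
    refine Finset.sum_le_sum fun e he => ?_
    rw [← mul_add]
    refine mul_le_mul_of_nonneg_left ?_ (hc e)
    have h2 : ∏ v ∈ e, condProb μ p U ω v = ∏ v ∈ e, cexp μ U (ind {v}) ω :=
      Finset.prod_congr rfl fun v hv => by
        rw [condProb, if_neg (Finset.disjoint_left.1 (Finset.mem_filter.1 he).2 hv)]
    rw [h2]
    linarith [le_abs_self (∏ v ∈ e, cexp μ U (ind {v}) ω - cexp μ U (ind e) ω)]
  · refine le_trans ?_ (mul_le_mul_of_nonneg_left (sum_not_disjoint_le hc U) (pow_nonneg hp r))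
    rw [Finset.mul_sum]
    refine Finset.sum_le_sum fun e _ => ?_
    by_cases h0 : c e = 0
    · simp [h0]
    rw [mul_comm (p ^ r), ← hr e h0]
    refine mul_le_mul_of_nonneg_left ?_ (hc e)
    refine (Finset.prod_le_prod (fun v _ => (hQ v).1) fun v _ => (hQ v).2).trans_eq ?_
    rw [Finset.prod_const]

lemma sum_mul_err_le {μ : Finset V → ℝ} {p : ℝ} {r : ℕ} {c : Finset V → ℝ}
    (hμ : ∀ ω, 0 ≤ μ ω) (hp : 0 < p) (h : NegativelyBiased μ p)
    (hc : ∀ e, 0 ≤ c e) (hr : ∀ e, c e ≠ 0 → e.card = r) (U : Finset V) :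
    ∑ ω, μ ω * ∑ e with Disjoint e U,
        c e * |∏ v ∈ e, cexp μ U (ind {v}) ω - cexp μ U (ind e) ω| ≤
      p ^ r * (p⁻¹ * ∑ v ∈ Uᶜ, ∑ S ∈ ((insert v U)ᶜ).powerset,
        codeg c (insert v S) * (p ^ S.card)⁻¹ * ∑ ω, μ ω * |condCov μ U S v ω|) := by
  have h1 : ∀ ω, μ ω * ∑ e with Disjoint e U,
      c e * |∏ v ∈ e, cexp μ U (ind {v}) ω - cexp μ U (ind e) ω| ≤
      μ ω * (p ^ r * ∑ v ∈ Uᶜ, ∑ S ∈ ((insert v U)ᶜ).powerset,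
        codeg c (insert v S) * ((p ^ (S.card + 1))⁻¹ * |condCov μ U S v ω|)) := by
    intro ω
    rcases (hμ ω).eq_or_lt with h0 | h0
    · simp [← h0]
    refine mul_le_mul_of_nonneg_left ?_ h0.le
    refine le_trans ?_ (mul_le_mul_of_nonneg_left (sum_disjoint_le hc U
      (g := fun v S => (p ^ (S.card + 1))⁻¹ * |condCov μ U S v ω|)
      fun v S => by positivity) (by positivity))
    rw [Finset.mul_sum]
    refine Finset.sum_le_sum fun e he => ?_
    by_cases hce : c e = 0
    · simp [hce]
    have h2 := abs_prod_cexp_sub_le hμ hp h (Finset.mem_filter.1 he).2 h0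
    rw [hr e hce] at h2
    refine (mul_le_mul_of_nonneg_left h2 (hc e)).trans_eq ?_
    ring
  refine (Finset.sum_le_sum fun ω _ => h1 ω).trans_eq ?_
  simp_rw [Finset.mul_sum]
  rw [Finset.sum_comm]
  refine Finset.sum_congr rfl fun v _ => ?_
  rw [Finset.sum_comm]
  refine Finset.sum_congr rfl fun S _ => Finset.sum_congr rfl fun ω _ => ?_
  rw [pow_succ, mul_inv]
  ring

/-- The lower tail bound for multilinear polynomials given by their weights. -/
theorem lower_tail_weights [Nonempty V] {c : Finset V → ℝ} {r : ℕ} {p η ε K Φ : ℝ}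
    (hc : ∀ e, 0 ≤ c e) (hr : ∀ e, c e ≠ 0 → e.card = r) (hr1 : r ≠ 0)
    (hp0 : 0 < p) (hp1 : p < 1)
    (hε : 0 < ε) (hε1 : ε ≤ 1) (hK : 1 ≤ K) (hη : 0 ≤ η) (hN : 0 < ∑ e, c e)
    (hd : ∀ B : Finset V, B.Nonempty → codeg c B ≤
      K * (∑ e, c e) / Fintype.card V *
        (ε / (2 * K) * (ε ^ 2 / (2 * 4 ^ r * K)) ^ 2 * p) ^ (B.card - 1))
    (hΦ0 : 0 ≤ Φ)
    (hΦ : ∀ q : V → ℝ, (∀ v, q v ∈ Set.Icc 0 p) →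
      ∑ e, c e * ∏ v ∈ e, q v ≤ (η + ε) * (p ^ r * ∑ e, c e) → Φ ≤ ∑ v, ip p (q v)) :
    (1 - ε) * Φ ≤ -Real.log (∑ ω : Finset V,
      if ∑ e, c e * ind e ω ≤ η * (p ^ r * ∑ e, c e) then pw (fun _ => p) ω else 0) := by
  set N := ∑ e, c e with hNdef
  set A : Finset V → Prop := fun ω => ∑ e, c e * ind e ω ≤ η * (p ^ r * N) with hAdef
  set Z : ℝ := ∑ ω : Finset V, if A ω then pw (fun _ => p) ω else 0 with hZdef
  set δ := ε / (2 * K) with hδdef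
  set γ := ε ^ 2 / (2 * 4 ^ r * K) with hγdef
  set n : ℝ := (Fintype.card V : ℝ) with hn
  set L := K * N / n with hLdef
  have hn0 : 0 < n := by simp [hn, Fintype.card_pos]
  have hK0 : 0 < K := by linarith
  have hδ : 0 < δ := by positivity
  have hγ : 0 < γ := by positivity
  have hL : 0 < L := by positivity
  have hδγ : δ * γ ^ 2 ≤ 1 := by
    have h1 : δ ≤ 1 := by rw [hδdef, div_le_one (by positivity)]; linarith
    have h4 : (1 : ℝ) ≤ 4 ^ r := one_le_pow₀ (by norm_num)
    have h2 : γ ≤ 1 := by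
      rw [hγdef, div_le_one (by positivity)]
      nlinarith
    exact mul_le_one₀ h1 (by positivity) (pow_le_one₀ hγ.le h2)
  have hpw : ∀ ω : Finset V, 0 ≤ pw (fun _ => p) ω :=
    pw_nonneg (q := fun _ : V => p) (fun _ => ⟨hp0.le, hp1.le⟩)
  have hpw0 : 0 < pw (fun _ : V => p) ∅ := pw_pos (by simp) fun v _ => hp1
  have hAempty : A ∅ := by
    have : ∑ e, c e * ind e ∅ = 0 := Finset.sum_eq_zero fun e _ => by
      by_cases he : c e = 0
      · simp [he]
      · have : e ≠ ∅ := fun h => hr1 (by simpa [h] using (hr e he).symm)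
        simp [ind, this]
    change _ ≤ _
    rw [this]
    positivity
  have hZ : 0 < Z := by
    refine Finset.sum_pos' (fun ω _ => ?_) ⟨∅, Finset.mem_univ _, ?_⟩
    · split_ifs
      · exact hpw ω
      · exact le_rfl
    · rwa [if_pos hAempty]
  have hlower : ∀ v ω, A (insert v ω) → A ω := fun v ω h => by
    refine le_trans (Finset.sum_le_sum fun e _ => mul_le_mul_of_nonneg_left ?_ (hc e)) h
    unfold ind
    split_ifs with h1 h2 h2
    · exact le_rfl
    · exact absurd (h1.trans (Finset.subset_insert v ω)) h2
    · norm_num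
    · exact le_rfl
  have hnb := negativelyBiased_of_lowerSet hlower hp0.le hp1.le hZ.le
  set μ : Finset V → ℝ := fun ω => if A ω then pw (fun _ : V => p) ω / Z else 0 with hμdef
  have hμ : ∀ ω, 0 ≤ μ ω := fun ω => by
    simp only [hμdef]
    split_ifs
    · exact div_nonneg (hpw ω) hZ.le
    · exact le_rfl
  have hμA : ∀ ω, 0 < μ ω → A ω := fun ω h => by
    by_contra h'
    simp [hμdef, h'] at h
  have hμZ : ∀ ω, 0 < μ ω → pw (fun _ => p) ω = μ ω * Z := fun ω h => by
    simp only [hμdef, if_pos (hμA ω h)]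
    field_simp
  have hμ1 : ∑ ω, μ ω = 1 := by
    rw [← div_self hZ.ne', hZdef, Finset.sum_div]
    exact Finset.sum_congr rfl fun ω _ => by simp only [hμdef]; split_ifs <;> simp [hZdef]
  obtain ⟨U, hUcard, hU⟩ := exists_pinning hμ hμ1 hp0 hnb hδ
  set Err : Finset V → ℝ := fun ω => ∑ e with Disjoint e U,
    c e * |∏ v ∈ e, cexp μ U (ind {v}) ω - cexp μ U (ind e) ω| with hErr
  set EX := p ^ r * N with hEX
  have hEX0 : 0 < EX := by positivity
  have hErrsum : ∑ ω, μ ω * Err ω ≤ ε ^ 2 / 2 * EX := by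
    refine (sum_mul_err_le hμ hp0 hnb hc hr U).trans ?_
    have h1 := sum_codeg_mul_condCov_le hμ hμ1 hp0 hnb hδ hγ hδγ hc hr hL hd hU
    refine (mul_le_mul_of_nonneg_left (mul_le_mul_of_nonneg_left h1 (inv_nonneg.2 hp0.le))
      (pow_nonneg hp0.le r)).trans_eq ?_
    rw [hγdef, hLdef, hEX, ← hn]
    field_simp
  have hcodeg : ∑ v ∈ U, codeg c {v} ≤ ε / 2 * N := by
    have h1 : ∀ v ∈ U, codeg c {v} ≤ L := fun v _ => by
      simpa using hd {v} (Finset.singleton_nonempty v)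
    refine (Finset.sum_le_card_nsmul _ _ _ h1).trans ?_
    rw [nsmul_eq_mul]
    refine (mul_le_mul_of_nonneg_right hUcard hL.le).trans_eq ?_
    rw [hLdef, hδdef, ← hn]
    field_simp
  have hpt : ∀ ω, μ ω * (Φ * (1 - Err ω / (ε / 2 * EX))) ≤
      μ ω * ∑ v, ip p (condProb μ p U ω v) := by
    intro ω
    have hmem := condProb_mem hμ hp0.le hnb U ω
    have hErr0 : 0 ≤ Err ω := Finset.sum_nonneg fun e _ => mul_nonneg (hc e) (abs_nonneg _)
    refine mul_le_mul_of_nonneg_left ?_ (hμ ω)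
    rcases le_total (Err ω) (ε / 2 * EX) with hle | hle
    · have h1 := sum_mul_prod_condProb_le hμ hp0.le hnb hc hr
        (b := η * EX) (by positivity) hμA U ω
      have h2 : p ^ r * ∑ v ∈ U, codeg c {v} ≤ ε / 2 * EX :=
        (mul_le_mul_of_nonneg_left hcodeg (pow_nonneg hp0.le r)).trans_eq (by rw [hEX]; ring)
      refine le_trans ?_ (hΦ _ hmem ?_)
      · refine mul_le_of_le_one_right hΦ0 ?_
        have : 0 ≤ Err ω / (ε / 2 * EX) := by positivity
        linarith
      · change _ ≤ Err ω + _ + _ at h1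
        linarith
    · refine le_trans (mul_nonpos_of_nonneg_of_nonpos hΦ0 ?_)
        (Finset.sum_nonneg fun v _ => ip_nonneg hp0 hp1 ⟨(hmem v).1, (hmem v).2.trans hp1.le⟩)
      rw [sub_nonpos, one_le_div (by positivity)]
      exact hle
  have hent := sum_mul_sum_ip_condProb_le hμ hμ1 hp0 hp1 hnb hZ hμZ U
  refine le_trans ?_ hent
  refine le_trans ?_ (Finset.sum_le_sum fun ω _ => hpt ω)
  have h1 : ∑ ω, μ ω * (Φ * (1 - Err ω / (ε / 2 * EX))) =
      Φ * (1 - (∑ ω, μ ω * Err ω) / (ε / 2 * EX)) := by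
    have : ∀ ω, μ ω * (Φ * (1 - Err ω / (ε / 2 * EX))) =
        Φ * μ ω - Φ / (ε / 2 * EX) * (μ ω * Err ω) := fun ω => by ring
    simp_rw [this]
    rw [Finset.sum_sub_distrib, ← Finset.mul_sum, ← Finset.mul_sum, hμ1]
    ring
  rw [h1, mul_comm]
  refine mul_le_mul_of_nonneg_left ?_ hΦ0
  have : (∑ ω, μ ω * Err ω) / (ε / 2 * EX) ≤ ε := by
    rw [div_le_iff₀ (by positivity)]
    linarith
  linarith

end LowerTail

section SquarefreeCoefficients

variable {V : Type*}

open MvPolynomial in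
/-- The coefficient of the squarefree monomial `∏_{v ∈ e} y_v`. -/
def sqfreeCoeff (f : MvPolynomial V ℝ) (e : Finset V) : ℝ :=
  coeff (∑ v ∈ e, Finsupp.single v 1) f

lemma card_eq_of_sqfreeCoeff_ne_zero {f : MvPolynomial V ℝ} {r : ℕ} (hf : f.IsHomogeneous r)
    {e : Finset V} (he : sqfreeCoeff f e ≠ 0) : e.card = r := by
  rw [← hf he]
  simp [Finsupp.weight_apply]

lemma foldr_pderiv_sum {ι : Type*} (l : List V) (s : Finset ι) (a : ι → ℝ)
    (g : ι → MvPolynomial V ℝ) :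
    l.foldr (fun v g => MvPolynomial.pderiv v g) (∑ i ∈ s, MvPolynomial.C (a i) * g i) =
      ∑ i ∈ s, MvPolynomial.C (a i) * l.foldr (fun v g => MvPolynomial.pderiv v g) (g i) := by
  induction l with
  | nil => simp
  | cons v l ih =>
    rw [List.foldr_cons, ih, map_sum]
    exact Finset.sum_congr rfl fun i _ => by rw [MvPolynomial.pderiv_C_mul, List.foldr_cons]

variable [DecidableEq V]

lemma sum_single_apply (e : Finset V) (u : V) :
    (∑ v ∈ e, Finsupp.single v 1 : V →₀ ℕ) u = if u ∈ e then 1 else 0 := by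
  rw [Finsupp.finsetSum_apply]
  simp [Finsupp.single_apply]

lemma pderiv_prod_X (v : V) (e : Finset V) :
    MvPolynomial.pderiv v (∏ u ∈ e, (MvPolynomial.X u : MvPolynomial V ℝ)) =
      if v ∈ e then ∏ u ∈ e.erase v, MvPolynomial.X u else 0 := by
  have h0 : ∀ s : Finset V, v ∉ s →
      MvPolynomial.pderiv v (∏ u ∈ s, (MvPolynomial.X u : MvPolynomial V ℝ)) = 0 := by
    intro s
    induction s using Finset.induction_on with
    | empty => simp
    | insert u s hu ih =>
      intro hv
      rw [Finset.mem_insert, not_or] at hv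
      rw [Finset.prod_insert hu, Derivation.leibniz, ih hv.2,
        MvPolynomial.pderiv_X_of_ne (Ne.symm hv.1)]
      simp
  split_ifs with h
  · rw [← Finset.mul_prod_erase e _ h, Derivation.leibniz, h0 _ (Finset.notMem_erase v e),
      MvPolynomial.pderiv_X_self]
    simp
  · exact h0 e h

lemma foldr_pderiv_prod_X {l : List V} (hl : l.Nodup) (e : Finset V) :
    l.foldr (fun v g => MvPolynomial.pderiv v g)
        (∏ u ∈ e, (MvPolynomial.X u : MvPolynomial V ℝ)) =
      if l.toFinset ⊆ e then ∏ u ∈ e \ l.toFinset, MvPolynomial.X u else 0 := by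
  induction l with
  | nil => simp
  | cons v l ih =>
    rw [List.nodup_cons] at hl
    rw [List.foldr_cons, ih hl.2]
    by_cases h : l.toFinset ⊆ e
    · rw [if_pos h, pderiv_prod_X]
      simp only [List.toFinset_cons, Finset.insert_subset_iff, Finset.mem_sdiff,
        List.mem_toFinset, hl.1, not_false_eq_true, and_true, h, Finset.sdiff_insert]
    · simp [Finset.insert_subset_iff, h]

variable [Fintype V]

lemma eq_sum_sqfreeCoeff {f : MvPolynomial V ℝ} (hf : ∀ m ∈ f.support, ∀ v, m v ≤ 1) :
    f = ∑ e : Finset V, MvPolynomial.C (sqfreeCoeff f e) * ∏ v ∈ e, MvPolynomial.X v := by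
  have hmon : ∀ e : Finset V, MvPolynomial.C (sqfreeCoeff f e) * ∏ v ∈ e, MvPolynomial.X v =
      MvPolynomial.monomial (∑ v ∈ e, Finsupp.single v 1 : V →₀ ℕ) (sqfreeCoeff f e) := by
    intro e
    rw [MvPolynomial.monomial_eq, Finsupp.prod_fintype _ _ (fun i => pow_zero _)]
    congr 1
    rw [← Finset.prod_subset (Finset.subset_univ e)]
    · refine Finset.prod_congr rfl fun v hv => ?_
      rw [sum_single_apply, if_pos hv, pow_one]
    · intro v _ hv
      rw [sum_single_apply, if_neg hv, pow_zero]
  ext m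
  simp_rw [hmon, MvPolynomial.coeff_sum, MvPolynomial.coeff_monomial]
  by_cases hm : ∀ v, m v ≤ 1
  · have hm' : (∑ v ∈ m.support, Finsupp.single v 1 : V →₀ ℕ) = m := by
      ext u
      rw [sum_single_apply]
      have := hm u
      split_ifs with h
      · rw [Finsupp.mem_support_iff] at h; omega
      · rw [Finsupp.notMem_support_iff] at h; omega
    rw [Finset.sum_eq_single m.support]
    · rw [if_pos hm', sqfreeCoeff, hm']
    · intro e _ he
      rw [if_neg]
      rintro rfl
      apply he
      ext u
      rw [Finsupp.mem_support_iff, sum_single_apply]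
      split_ifs with h <;> simp [h]
    · simp
  · rw [MvPolynomial.notMem_support_iff.1 fun h => hm (hf m h)]
    refine (Finset.sum_eq_zero fun e _ => if_neg ?_).symm
    rintro rfl
    refine hm fun v => ?_
    rw [sum_single_apply]
    split_ifs <;> norm_num

lemma eval_eq_sum {f : MvPolynomial V ℝ} (hf : ∀ m ∈ f.support, ∀ v, m v ≤ 1) (y : V → ℝ) :
    MvPolynomial.eval y f = ∑ e, sqfreeCoeff f e * ∏ v ∈ e, y v := by
  conv_lhs => rw [eq_sum_sqfreeCoeff hf]
  simp [map_sum, map_prod]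

lemma evalInd_eq_sum {f : MvPolynomial V ℝ} (hf : ∀ m ∈ f.support, ∀ v, m v ≤ 1)
    (ω : Finset V) : evalInd f ω = ∑ e, sqfreeCoeff f e * ind e ω := by
  rw [evalInd, eval_eq_sum hf]
  refine Finset.sum_congr rfl fun e _ => ?_
  rw [Finset.prod_ite_zero, Finset.prod_const_one]
  rfl

lemma expPoly_eq_sum {f : MvPolynomial V ℝ} (hf : ∀ m ∈ f.support, ∀ v, m v ≤ 1)
    (q : V → ℝ) : expPoly f q = ∑ e, sqfreeCoeff f e * ∏ v ∈ e, q v := by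
  unfold expPoly
  simp_rw [evalInd_eq_sum hf, ← sum_pw_mul_ind, Finset.mul_sum]
  rw [Finset.sum_comm]
  exact Finset.sum_congr rfl fun e _ => Finset.sum_congr rfl fun ω _ => by ring

lemma expPoly_const {f : MvPolynomial V ℝ} {r : ℕ} (hr : f.IsHomogeneous r)
    (hf : ∀ m ∈ f.support, ∀ v, m v ≤ 1) (p : ℝ) :
    expPoly f (fun _ => p) = p ^ r * ∑ e, sqfreeCoeff f e := by
  rw [expPoly_eq_sum hf, Finset.mul_sum]
  refine Finset.sum_congr rfl fun e _ => ?_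
  by_cases h : sqfreeCoeff f e = 0
  · simp [h]
  · rw [Finset.prod_const, card_eq_of_sqfreeCoeff_ne_zero hr h, mul_comm]

lemma eval_pderivB {f : MvPolynomial V ℝ} (hf : ∀ m ∈ f.support, ∀ v, m v ≤ 1)
    (B : Finset V) :
    MvPolynomial.eval (fun _ => (1 : ℝ)) (pderivB B f) = codeg (sqfreeCoeff f) B := by
  conv_lhs => rw [pderivB, eq_sum_sqfreeCoeff hf]
  rw [foldr_pderiv_sum, map_sum, codeg, Finset.sum_filter]
  refine Finset.sum_congr rfl fun e _ => ?_
  rw [foldr_pderiv_prod_X B.nodup_toList, Finset.toList_toFinset, map_mul, MvPolynomial.eval_C]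
  split_ifs <;> simp [map_prod]

end SquarefreeCoefficients

lemma phiPoly_nonneg {V : Type*} [Fintype V] [DecidableEq V] (f : MvPolynomial V ℝ) {p : ℝ}
    (hp0 : 0 < p) (hp1 : p < 1) (η : ℝ) : 0 ≤ PhiPoly f p η := by
  refine Real.sInf_nonneg ?_
  rintro x ⟨q, hq, -, rfl⟩
  exact Finset.sum_nonneg fun v _ => ip_nonneg hp0 hp1 (hq v)

lemma phiPoly_le {V : Type*} [Fintype V] [DecidableEq V] {f : MvPolynomial V ℝ} {p η : ℝ}
    (hp0 : 0 < p) (hp1 : p < 1) {q : V → ℝ} (hq : ∀ v, q v ∈ Set.Icc (0 : ℝ) 1)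
    (h : expPoly f q ≤ η * expPoly f (fun _ => p)) : PhiPoly f p η ≤ ∑ v, ip p (q v) := by
  refine csInf_le ⟨0, ?_⟩ ⟨q, hq, h, rfl⟩
  rintro x ⟨q, hq, -, rfl⟩
  exact Finset.sum_nonneg fun v _ => ip_nonneg hp0 hp1 (hq v)

lemma neg_log_prPoly_nonneg {V : Type*} [Fintype V] [DecidableEq V] (f : MvPolynomial V ℝ)
    {p : ℝ} (hp0 : 0 < p) (hp1 : p < 1) (η : ℝ) : 0 ≤ -Real.log (PrPoly f p η) := by
  have hpw : ∀ ω : Finset V, 0 ≤ pw (fun _ => p) ω :=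
    pw_nonneg (q := fun _ : V => p) (fun _ => ⟨hp0.le, hp1.le⟩)
  refine neg_nonneg.2 (Real.log_nonpos (Finset.sum_nonneg fun ω _ => ?_) ?_)
  · split_ifs
    · exact hpw ω
    · exact le_rfl
  · rw [← sum_pw (fun _ : V => p)]
    refine Finset.sum_le_sum fun ω _ => ?_
    split_ifs
    · exact le_rfl
    · exact hpw ω

/-- Theorem `thm:main`: for every integer `r` and all `p₀ < 1`, `ε > 0` and `K`, there
exist `λ > 0` and `C` such that the following holds.  Let `f` be an `r`-homogeneous
multilinear polynomial in the variables `(y_v)_{v ∈ V}` with nonnegative coefficients, let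
`p ∈ (0, p₀]`, and suppose that `∂_B f(𝟏) ≤ K (λp)^{|B|−1} f(𝟏)/|V|` for every nonempty
`B ⊆ V` with `|B| ≤ r`.  Then, with `X = f(Y)` for `Y` i.i.d. `Ber(p)`, for every `η ≥ 0`,
`− log Pr(X ≤ η E[X]) ≥ (1−ε) Φ_p^f(η+ε) − C`. -/
theorem main_polynomials (r : ℕ) (p₀ ε K : ℝ) (hp₀ : p₀ < 1) (hε : 0 < ε) :
    ∃ lam C : ℝ, 0 < lam ∧
      ∀ (V : Type) [Fintype V] [DecidableEq V] (f : MvPolynomial V ℝ),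
        f.IsHomogeneous r → (∀ m ∈ f.support, ∀ v, m v ≤ 1) →
        (∀ m, 0 ≤ MvPolynomial.coeff m f) →
        ∀ p : ℝ, 0 < p → p ≤ p₀ →
        (∀ B : Finset V, B.Nonempty → B.card ≤ r →
          MvPolynomial.eval (fun _ => (1 : ℝ)) (pderivB B f)
            ≤ K * (lam * p) ^ (B.card - 1) *
              (MvPolynomial.eval (fun _ => (1 : ℝ)) f / (Fintype.card V : ℝ))) →
        ∀ η : ℝ, 0 ≤ η →
          - Real.log (PrPoly f p η) ≥ (1 - ε) * PhiPoly f p (η + ε) - C := by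
  set K' := max K 1
  have hK' : 1 ≤ K' := le_max_right K 1
  have hK0 : 0 < K' := by linarith
  refine ⟨ε / (2 * K') * (ε ^ 2 / (2 * 4 ^ r * K')) ^ 2, 0, by positivity, ?_⟩
  intro V _ _ f hhom hmul hcoeff p hp0 hpp hd η hη
  have hp1 : p < 1 := by linarith
  rw [sub_zero, ge_iff_le]
  have hΦ0 := phiPoly_nonneg f hp0 hp1 (η + ε)
  have hlog := neg_log_prPoly_nonneg f hp0 hp1 η
  rcases lt_or_ge 1 ε with hε1 | hε1
  · exact (mul_nonpos_of_nonpos_of_nonneg (by linarith) hΦ0).trans hlog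
  suffices h : PhiPoly f p (η + ε) ≠ 0 →
      (1 - ε) * PhiPoly f p (η + ε) ≤ -Real.log (PrPoly f p η) by
    by_cases h0 : PhiPoly f p (η + ε) = 0
    · rwa [h0, mul_zero]
    · exact h h0
  intro hne
  set c := sqfreeCoeff f with hc
  have hc0 : ∀ e, 0 ≤ c e := fun e => hcoeff _
  have hcr : ∀ e, c e ≠ 0 → e.card = r := fun e => card_eq_of_sqfreeCoeff_ne_zero hhom
  have hEX := expPoly_const hhom hmul p
  rw [← hc] at hEX
  have hlt : (η + ε) * expPoly f (fun _ => p) < expPoly f (fun _ => p) := by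
    by_contra! h
    refine hne (le_antisymm ?_ hΦ0)
    refine (phiPoly_le hp0 hp1 (q := fun _ => p) (fun _ => ⟨hp0.le, hp1.le⟩) h).trans_eq ?_
    simp [ip_self]
  have hN : 0 < ∑ e, c e := by
    refine (Finset.sum_nonneg fun e _ => hc0 e).lt_of_ne' fun h => ?_
    rw [hEX, h] at hlt
    simp at hlt
  have hr1 : r ≠ 0 := by
    rintro rfl
    refine hne ?_
    rw [PhiPoly]
    convert Real.sInf_empty
    refine Set.eq_empty_of_forall_notMem ?_
    rintro x ⟨q, -, hq, -⟩
    have h0 : expPoly f q = expPoly f (fun _ => p) := by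
      rw [expPoly_eq_sum hmul, expPoly_eq_sum hmul]
      refine Finset.sum_congr rfl fun e _ => ?_
      by_cases he : c e = 0
      · simp [← hc, he]
      · rw [Finset.card_eq_zero.1 (hcr e he)]
        simp
    linarith
  obtain ⟨e, -, he⟩ := Finset.exists_ne_zero_of_sum_ne_zero hN.ne'
  obtain ⟨v, -⟩ := Finset.card_pos.1 (Nat.pos_of_ne_zero (hcr e he ▸ hr1))
  have : Nonempty V := ⟨v⟩
  have hmain := lower_tail_weights (Φ := PhiPoly f p (η + ε)) (K := K') (η := η)
    hc0 hcr hr1 hp0 hp1 hε hε1 hK' hη hN ?_ hΦ0 ?_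
  · simpa only [PrPoly, evalInd_eq_sum hmul, hEX] using hmain
  · intro B hB
    rcases lt_or_ge r B.card with hrB | hrB
    · rw [codeg_eq_zero hcr hrB]
      positivity
    · have h1 := hd B hB hrB
      rw [eval_pderivB hmul, eval_eq_sum hmul, ← hc] at h1
      simp only [Finset.prod_const_one, mul_one] at h1
      refine h1.trans ?_
      rw [mul_assoc, mul_comm (_ ^ _), ← mul_assoc, ← mul_div_assoc]
      gcongr
      exact le_max_left K 1
  · intro q hq hle
    refine phiPoly_le hp0 hp1 (fun v => ⟨(hq v).1, (hq v).2.trans hp1.le⟩) ?_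
    rw [expPoly_eq_sum hmul, hEX]
    exact hle

end
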